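/- arXiv:2401.06770 — 2 statements merged into one kernel-verified Lean document; each statement's English description precedes it below -/
import Mathlib

section
/- Under the stated hypotheses on the kernel κ, there exist constants c, C > 0 such that for every ε ∈ (0,1/2) the following holds for all sufficiently large n: for every integer j ≥ 1, the chain started at 1 satisfies P₁( there exists k with A_k ≥ εn, and A_k < εn for all k < j·ε·n ) ≤ C·e^{−c·j}/(ε n). In words: if the chain ever reaches level εn, it is exponentially unlikely to do so only after time j·ε·n. -/
open MeasureTheory ProbabilityTheory Filter

/-- `P` is the law on path space `ℕ^ℕ` of the homogeneous Markov chain with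
transition kernel `κ` started at `x`, characterized by its cylinder probabilities
(this determines the Ionescu–Tulcea measure uniquely). -/
def IsChainLaw (κ : Kernel ℕ ℕ) (x : ℕ) (P : Measure (ℕ → ℕ)) : Prop :=
  ∀ (k : ℕ) (y : Fin (k + 1) → ℕ),
    P {ω | ∀ i : Fin (k + 1), ω i.val = y i} =
      (if y 0 = x then 1 else 0) * ∏ i : Fin k, (κ (y i.castSucc)) {y i.succ}

lemma chain_lintegral {κ : Kernel ℕ ℕ} {x : ℕ} {P : Measure (ℕ → ℕ)} (hP : IsChainLaw κ x P)
    (k : ℕ) (F : (Fin (k + 1) → ℕ) → ENNReal) :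
    ∫⁻ ω, F (fun i => ω i.val) ∂P =
      ∑' y : Fin (k + 1) → ℕ, F y *
        ((if y 0 = x then 1 else 0) * ∏ i : Fin k, (κ (y i.castSucc)) {y i.succ}) := by
  have hm : Measurable (fun (ω : ℕ → ℕ) (i : Fin (k + 1)) => ω i.val) := by fun_prop
  have h1 := lintegral_map (μ := P) (Measurable.of_discrete (f := F)) hm
  rw [← h1, lintegral_countable']
  refine tsum_congr fun y => ?_
  rw [Measure.map_apply hm (measurableSet_singleton y), ← hP k y]
  congr 2
  ext ω
  simp [funext_iff]

lemma chain_markov {κ : Kernel ℕ ℕ} {x : ℕ} {P : Measure (ℕ → ℕ)} (hP : IsChainLaw κ x P)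
    (k : ℕ) (G : (Fin (k + 1) → ℕ) → ENNReal) (f : ℕ → ENNReal) :
    ∫⁻ ω, G (fun i => ω i.val) * f (ω (k + 1)) ∂P =
      ∫⁻ ω, G (fun i => ω i.val) * (∫⁻ y, f y ∂(κ (ω k))) ∂P := by
  have h1 := chain_lintegral hP (k + 1) (fun y => G (fun i => y i.castSucc) * f (y (Fin.last _)))
  have h2 := chain_lintegral hP k (fun y => G y * (∫⁻ z, f z ∂(κ (y (Fin.last _)))))
  simp only [Fin.val_castSucc, Fin.val_last] at h1 h2
  rw [h1, h2, ← (Fin.snocEquiv (fun _ : Fin (k + 1 + 1) => ℕ)).tsum_eq, ENNReal.tsum_prod',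
    ENNReal.tsum_comm]
  refine tsum_congr fun y => ?_
  rw [lintegral_countable', ← ENNReal.tsum_mul_left, ← ENNReal.tsum_mul_right]
  refine tsum_congr fun z => ?_
  have h0 : (Fin.snoc (α := fun _ => ℕ) y z : Fin (k + 1 + 1) → ℕ) 0 = y 0 := by
    rw [← Fin.castSucc_zero, Fin.snoc_castSucc]
  rw [Fin.prod_univ_castSucc]
  simp only [Fin.snocEquiv_apply, Fin.snoc_castSucc, Fin.snoc_last, h0, Fin.succ_last,
    ← Fin.castSucc_succ]
  ring

/-- the set of paths staying below `M` up to time `k` -/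
def stayBelow (M : ℝ) (k : ℕ) : Set (ℕ → ℕ) := {ω | ∀ i : ℕ, i ≤ k → (ω i : ℝ) < M}

lemma measurableSet_stayBelow (M : ℝ) (k : ℕ) : MeasurableSet (stayBelow M k) := by
  have : stayBelow M k = ⋂ i : ℕ, ⋂ _ : i ≤ k, (fun ω : ℕ → ℕ => ω i) ⁻¹' {m | (m : ℝ) < M} := by
    ext ω; simp [stayBelow]
  rw [this]
  exact MeasurableSet.iInter fun i => MeasurableSet.iInter fun _ =>
    (measurable_pi_apply i) (MeasurableSet.of_discrete)

lemma stayBelow_succ (M : ℝ) (k : ℕ) :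
    stayBelow M (k + 1) = stayBelow M k ∩ {ω | (ω (k + 1) : ℝ) < M} := by
  ext ω
  simp only [stayBelow, Set.mem_setOf_eq, Set.mem_inter_iff]
  constructor
  · exact fun h => ⟨fun i hi => h i (by omega), h _ le_rfl⟩
  · rintro ⟨h, h'⟩ i hi
    rcases Nat.lt_or_ge k i with h1 | h1
    · obtain rfl : i = k + 1 := by omega
      exact h'
    · exact h i h1

lemma chain_step {κ : Kernel ℕ ℕ} {x : ℕ} {P : Measure (ℕ → ℕ)} (hP : IsChainLaw κ x P)
    (M : ℝ) (k : ℕ) (f : ℕ → ENNReal) :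
    ∫⁻ ω in stayBelow M k, f (ω (k + 1)) ∂P =
      ∫⁻ ω in stayBelow M k, (∫⁻ y, f y ∂(κ (ω k))) ∂P := by
  classical
  have h := chain_markov hP k (fun y => if ∀ i, (y i : ℝ) < M then 1 else 0) f
  rw [← lintegral_indicator (measurableSet_stayBelow M k),
    ← lintegral_indicator (measurableSet_stayBelow M k)]
  have key : ∀ (ω : ℕ → ℕ), (∀ i : Fin (k + 1), (ω i.val : ℝ) < M) ↔ ω ∈ stayBelow M k := by
    intro ω
    simp only [stayBelow, Set.mem_setOf_eq]
    exact ⟨fun h i hi => h ⟨i, by omega⟩, fun h i => h i.val (by omega)⟩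
  simp only [key] at h
  convert h using 2 <;>
  · funext ω
    by_cases hω : ω ∈ stayBelow M k <;> simp [hω]

/-- generic decay -/
lemma chain_decay {κ : Kernel ℕ ℕ} {x : ℕ} {P : Measure (ℕ → ℕ)} (hP : IsChainLaw κ x P)
    (M : ℝ) (g : ℕ → ENNReal) (r : ENNReal)
    (hg : ∀ x : ℕ, (x : ℝ) < M → ∫⁻ y, g y ∂(κ x) ≤ r * g x) (k : ℕ) :
    ∫⁻ ω in stayBelow M k, g (ω k) ∂P ≤ r ^ k * g x := by
  induction k with
  | zero =>
    have h := chain_lintegral hP 0 (fun y => g (y 0))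
    calc ∫⁻ ω in stayBelow M 0, g (ω 0) ∂P ≤ ∫⁻ ω, g (ω 0) ∂P := setLIntegral_le_lintegral _ _
      _ = g x := by
        simp only [Fin.val_zero] at h
        rw [h, tsum_eq_single (fun _ => x)]
        · simp
        · intro y hy
          have : y 0 ≠ x := fun h => hy (by funext i; obtain rfl : i = 0 := Fin.ext (by simp); exact h)
          simp [this]
      _ ≤ _ := by simp
  | succ k ih =>
    calc ∫⁻ ω in stayBelow M (k + 1), g (ω (k + 1)) ∂P
        ≤ ∫⁻ ω in stayBelow M k, g (ω (k + 1)) ∂P := by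
          apply lintegral_mono_set
          rw [stayBelow_succ]; exact Set.inter_subset_left
      _ = ∫⁻ ω in stayBelow M k, (∫⁻ y, g y ∂(κ (ω k))) ∂P := chain_step hP M k g
      _ ≤ ∫⁻ ω in stayBelow M k, r * g (ω k) ∂P := by
          apply setLIntegral_mono' (measurableSet_stayBelow M k)
          intro ω hω
          exact hg _ (hω k le_rfl)
      _ = r * ∫⁻ ω in stayBelow M k, g (ω k) ∂P := by
          rw [lintegral_const_mul]
          exact (Measurable.of_discrete (f := g)).comp (measurable_pi_apply k)
      _ ≤ r * (r ^ k * g x) := by gcongr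
      _ = _ := by ring

lemma chain_exit {κ : Kernel ℕ ℕ} {x : ℕ} {P : Measure (ℕ → ℕ)} [IsProbabilityMeasure P]
    (hP : IsChainLaw κ x P)
    (M : ℝ) (hmean : ∀ x : ℕ, ∫⁻ y, (y : ENNReal) ∂(κ x) ≤ x) (k l : ℕ) :
    ENNReal.ofReal M * P (stayBelow M k \ stayBelow M (k + l)) +
      ∫⁻ ω in stayBelow M (k + l), (ω (k + l) : ENNReal) ∂P ≤
    ∫⁻ ω in stayBelow M k, (ω k : ENNReal) ∂P := by
  induction l with
  | zero => simp
  | succ l ih =>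
    refine le_trans ?_ ih
    have hS := measurableSet_stayBelow M
    have hsub : stayBelow M (k + l + 1) ⊆ stayBelow M (k + l) := by
      rw [stayBelow_succ]; exact Set.inter_subset_left
    have hmeas : ∀ i, Measurable (fun ω : ℕ → ℕ => (ω i : ENNReal)) := fun i =>
      (Measurable.of_discrete (f := fun m : ℕ => (m : ENNReal))).comp (measurable_pi_apply i)
    have hP1 : P (stayBelow M k \ stayBelow M (k + l + 1)) ≤
        P (stayBelow M k \ stayBelow M (k + l)) +
          P (stayBelow M (k + l) \ stayBelow M (k + l + 1)) := by
      refine le_trans (measure_mono ?_) (measure_union_le _ _)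
      intro ω hω
      by_cases h : ω ∈ stayBelow M (k + l)
      · exact Or.inr ⟨h, hω.2⟩
      · exact Or.inl ⟨hω.1, h⟩
    have hstep : ENNReal.ofReal M * P (stayBelow M (k + l) \ stayBelow M (k + l + 1)) +
        ∫⁻ ω in stayBelow M (k + l + 1), (ω (k + l + 1) : ENNReal) ∂P ≤
        ∫⁻ ω in stayBelow M (k + l), (ω (k + l) : ENNReal) ∂P := by
      calc _ ≤ ∫⁻ ω in stayBelow M (k + l) \ stayBelow M (k + l + 1),
              (ω (k + l + 1) : ENNReal) ∂P +
            ∫⁻ ω in stayBelow M (k + l + 1), (ω (k + l + 1) : ENNReal) ∂P := by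
            gcongr
            rw [← setLIntegral_const]
            apply setLIntegral_mono' ((hS _).diff (hS _))
            intro ω hω
            have : M ≤ (ω (k + l + 1) : ℝ) := by
              by_contra hlt
              exact hω.2 (by rw [stayBelow_succ]; exact ⟨hω.1, not_le.1 hlt⟩)
            calc ENNReal.ofReal M ≤ ENNReal.ofReal (ω (k + l + 1) : ℝ) :=
                  ENNReal.ofReal_le_ofReal this
              _ = _ := ENNReal.ofReal_natCast _
        _ = ∫⁻ ω in stayBelow M (k + l), (ω (k + l + 1) : ENNReal) ∂P := by
            rw [← lintegral_union (hS _) Set.disjoint_sdiff_left, Set.diff_union_of_subset hsub]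
        _ = ∫⁻ ω in stayBelow M (k + l), (∫⁻ y, (y : ENNReal) ∂(κ (ω (k + l)))) ∂P :=
            chain_step hP M (k + l) (fun y => (y : ENNReal))
        _ ≤ _ := lintegral_mono fun ω => hmean _
    rw [← Nat.add_assoc]
    calc _ ≤ ENNReal.ofReal M * (P (stayBelow M k \ stayBelow M (k + l)) +
          P (stayBelow M (k + l) \ stayBelow M (k + l + 1))) +
          ∫⁻ ω in stayBelow M (k + l + 1), (ω (k + l + 1) : ENNReal) ∂P := by
            gcongr
      _ = ENNReal.ofReal M * P (stayBelow M k \ stayBelow M (k + l)) +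
          (ENNReal.ofReal M * P (stayBelow M (k + l) \ stayBelow M (k + l + 1)) +
          ∫⁻ ω in stayBelow M (k + l + 1), (ω (k + l + 1) : ENNReal) ∂P) := by ring
      _ ≤ _ := by gcongr

/-- probability of staying below `M` up to `k` and exceeding `M` eventually -/
lemma chain_exit_all {κ : Kernel ℕ ℕ} {x : ℕ} {P : Measure (ℕ → ℕ)} [IsProbabilityMeasure P]
    (hP : IsChainLaw κ x P)
    (M : ℝ) (hmean : ∀ x : ℕ, ∫⁻ y, (y : ENNReal) ∂(κ x) ≤ x) (k : ℕ) :
    ENNReal.ofReal M * P (⋃ l, stayBelow M k \ stayBelow M (k + l)) ≤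
    ∫⁻ ω in stayBelow M k, (ω k : ENNReal) ∂P := by
  rw [Monotone.measure_iUnion, ENNReal.mul_iSup]
  · exact iSup_le fun l => le_trans le_self_add (chain_exit hP M hmean k l)
  · intro l l' hl
    refine Set.diff_subset_diff_right ?_
    intro ω hω i hi
    exact hω i (by omega)

/-- truncated lower variance bound -/
lemma lower_var (σ : ℝ) (hσ : 0 < σ) (κ : Kernel ℕ ℕ) [IsMarkovKernel κ]
    (hmom : ∀ n : ℕ, Integrable (fun m : ℕ => (m : ℝ) ^ 2) (κ n))
    (hmart : ∀ a : ℕ, ∫ m, (m : ℝ) ∂(κ a) = a)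
    (hlb : ∃ s : ℝ, 0 < s ∧ ∀ n : ℕ, 1 ≤ n → s ≤ ∫ m, ((m : ℝ) - n) ^ 2 ∂(κ n))
    (hclt : ∀ f : BoundedContinuousFunction ℝ ℝ,
      Tendsto (fun n : ℕ => ∫ m, f (((m : ℝ) - n) / Real.sqrt n) ∂(κ n)) atTop
        (nhds (∫ x, f x ∂(gaussianReal 0 (Real.toNNReal (σ ^ 2)))))) :
    ∃ a : ℝ, 0 < a ∧ ∀ n : ℕ, a * n ≤ ∫ m, (max ((n : ℝ) - m) 0) ^ 2 ∂(κ n) := by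
  have hmom1 : ∀ n, Integrable (fun m : ℕ => (m : ℝ)) (κ n) := by
    intro n
    refine (hmom n).mono' (Measurable.of_discrete.aestronglyMeasurable) (ae_of_all _ fun m => ?_)
    rw [Real.norm_natCast]
    exact_mod_cast Nat.le_self_pow two_ne_zero m
  have hint : ∀ n : ℕ, Integrable (fun m : ℕ => (max ((n : ℝ) - m) 0) ^ 2) (κ n) := by
    intro n
    refine (integrable_const ((n : ℝ) ^ 2)).mono' (Measurable.of_discrete.aestronglyMeasurable)
      (ae_of_all _ fun m => ?_)
    rw [Real.norm_eq_abs, abs_of_nonneg (by positivity)]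
    have : (0 : ℝ) ≤ m := by positivity
    have : (0 : ℝ) ≤ n := by positivity
    gcongr
    exact max_le (by linarith) (by linarith)
  -- positivity for each n ≥ 1
  have hpos : ∀ n : ℕ, 1 ≤ n → 0 < ∫ m, (max ((n : ℝ) - m) 0) ^ 2 ∂(κ n) := by
    intro n hn
    obtain ⟨s, hs, hlb⟩ := hlb
    rcases (integral_nonneg (μ := κ n) (f := fun m : ℕ => (max ((n : ℝ) - m) 0) ^ 2)
      (fun m => by positivity)).lt_or_eq with h | h
    · exact h
    exfalso
    have h1 := (integral_eq_zero_iff_of_nonneg (fun m => by positivity) (hint n)).1 h.symm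
    have h2 : ∀ᵐ m : ℕ ∂(κ n), 0 ≤ (m : ℝ) - n := by
      filter_upwards [h1] with m hm
      have hm : (max ((n : ℝ) - m) 0) ^ 2 = 0 := hm
      have := pow_eq_zero_iff two_ne_zero |>.1 hm
      have := le_max_left ((n : ℝ) - m) 0
      linarith
    have h3 : ∫ m, ((m : ℝ) - n) ∂(κ n) = 0 := by
      rw [integral_sub (hmom1 n) (integrable_const _), hmart]; simp
    have h4 := (integral_eq_zero_iff_of_nonneg_ae h2 ((hmom1 n).sub (integrable_const _))).1 h3
    have h5 : ∫ m, ((m : ℝ) - n) ^ 2 ∂(κ n) = 0 := by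
      rw [integral_eq_zero_of_ae]
      filter_upwards [h4] with m hm
      have hm : (m : ℝ) - n = 0 := hm
      simp [hm]
    have := hlb n hn
    linarith
  -- the test function
  let f : BoundedContinuousFunction ℝ ℝ := BoundedContinuousFunction.ofNormedAddCommGroup
    (fun y : ℝ => (min (max (-y) 0) 1) ^ 2) (by fun_prop) 1 (by
      intro y
      rw [Real.norm_eq_abs, abs_of_nonneg (by positivity)]
      have h0 : 0 ≤ min (max (-y) 0) 1 := le_min (le_max_right _ _) zero_le_one
      exact pow_le_one₀ h0 (min_le_right _ _))
  have hf : ∀ y, f y = (min (max (-y) 0) 1) ^ 2 := fun y => rfl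
  have hfpos : 0 < ∫ x, f x ∂(gaussianReal 0 (Real.toNNReal (σ ^ 2))) := by
    have hne : Real.toNNReal (σ ^ 2) ≠ 0 := by
      rw [Ne, Real.toNNReal_eq_zero, not_le]; positivity
    rw [integral_pos_iff_support_of_nonneg (fun y => by rw [hf]; positivity) (f.integrable _)]
    have hsub : Set.Iio (0 : ℝ) ⊆ Function.support (fun x => f x) := by
      intro y hy
      have hy : y < 0 := hy
      have : 0 < min (max (-y) 0) 1 := lt_min (lt_max_of_lt_left (by linarith)) one_pos
      simp only [Function.mem_support, hf]
      positivity
    refine lt_of_lt_of_le ?_ (measure_mono hsub)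
    rw [pos_iff_ne_zero]
    intro h0
    have := gaussianReal_absolutelyContinuous' 0 hne h0
    simp at this
  set L := ∫ x, f x ∂(gaussianReal 0 (Real.toNNReal (σ ^ 2))) with hL
  have hev := (hclt f).eventually (lt_mem_nhds (half_lt_self hfpos))
  obtain ⟨N, hN⟩ := eventually_atTop.1 hev
  have hbig : ∀ n : ℕ, N ≤ n → 1 ≤ n → L / 2 * n ≤ ∫ m, (max ((n : ℝ) - m) 0) ^ 2 ∂(κ n) := by
    intro n hn hn1
    have hn0 : (0 : ℝ) < n := by exact_mod_cast hn1
    calc L / 2 * n ≤ (∫ m, f (((m : ℝ) - n) / Real.sqrt n) ∂(κ n)) * n := by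
          have := hN n hn
          gcongr
      _ = ∫ m, f (((m : ℝ) - n) / Real.sqrt n) * n ∂(κ n) := by rw [integral_mul_const]
      _ ≤ _ := by
          refine integral_mono_of_nonneg (ae_of_all _ fun m => ?_) (hint n)
            (ae_of_all _ fun m => ?_)
          · simp only [hf]; positivity
          · simp only [hf]
            have hs : 0 < Real.sqrt n := Real.sqrt_pos.2 hn0
            have h0 : 0 ≤ min (max (-(((m : ℝ) - n) / Real.sqrt n)) 0) 1 :=
              le_min (le_max_right _ _) zero_le_one
            have h1 : min (max (-(((m : ℝ) - n) / Real.sqrt n)) 0) 1 * Real.sqrt n ≤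
                max ((n : ℝ) - m) 0 := by
              calc _ ≤ max (-(((m : ℝ) - n) / Real.sqrt n)) 0 * Real.sqrt n := by
                    gcongr; exact min_le_left _ _
                _ = max ((n : ℝ) - m) 0 := by
                    rw [max_mul_of_nonneg _ _ hs.le, zero_mul]
                    congr 1
                    field_simp
                    ring
            calc _ = (min (max (-(((m : ℝ) - n) / Real.sqrt n)) 0) 1 * Real.sqrt n) ^ 2 := by
                  rw [mul_pow, Real.sq_sqrt hn0.le]
              _ ≤ _ := by gcongr
  -- small n
  have hsmall : ∀ K : ℕ, ∃ a : ℝ, 0 < a ∧ ∀ n : ℕ, n < K →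
      a * n ≤ ∫ m, (max ((n : ℝ) - m) 0) ^ 2 ∂(κ n) := by
    intro K
    induction K with
    | zero => exact ⟨1, one_pos, fun n hn => by omega⟩
    | succ K ih =>
      obtain ⟨a, ha, h⟩ := ih
      rcases Nat.eq_zero_or_pos K with rfl | hK
      · refine ⟨1, one_pos, fun n hn => ?_⟩
        obtain rfl : n = 0 := by omega
        rw [Nat.cast_zero, mul_zero]
        exact integral_nonneg fun m => by positivity
      · have hK0 : (0 : ℝ) < K := by exact_mod_cast hK
        have hp := hpos K hK
        refine ⟨min a ((∫ m, (max ((K : ℝ) - m) 0) ^ 2 ∂(κ K)) / K), lt_min ha (by positivity),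
          fun n hn => ?_⟩
        rcases Nat.lt_succ_iff_lt_or_eq.1 hn with h1 | rfl
        · refine le_trans ?_ (h n h1)
          gcongr
          exact min_le_left _ _
        · calc _ ≤ (∫ m, (max ((n : ℝ) - m) 0) ^ 2 ∂(κ n)) / n * n := by
                gcongr
                exact min_le_right _ _
            _ = _ := by field_simp
  obtain ⟨a, ha, h⟩ := hsmall (N + 1)
  refine ⟨min a (L / 2), lt_min ha (by positivity), fun n => ?_⟩
  rcases Nat.lt_or_ge n (N + 1) with h1 | h1
  · refine le_trans ?_ (h n h1)
    gcongr
    exact min_le_left _ _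
  · refine le_trans ?_ (hbig n (by omega) (by omega))
    gcongr
    exact min_le_right _ _

/-- the Lyapunov function -/
noncomputable def lyap (M y : ℝ) : ℝ := if y ≤ M then y * (2 * M - y) else M ^ 2

lemma lyap_le {M x y : ℝ} (hxM : x < M) :
    lyap M y ≤ lyap M x + (2 * M - 2 * x) * (y - x) - (max (x - y) 0) ^ 2 := by
  unfold lyap
  rw [if_pos hxM.le]
  rcases le_total y x with h | h
  · rw [if_pos (h.trans hxM.le), max_eq_left (by linarith)]
    nlinarith
  · rw [max_eq_right (by linarith)]
    split_ifs with h1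
    · nlinarith [sq_nonneg (x - y)]
    · nlinarith [sq_nonneg (M - x), mul_nonneg (sub_nonneg.2 hxM.le) (sub_nonneg.2 (not_le.1 h1).le)]

lemma lyap_nonneg {M y : ℝ} (hy : 0 ≤ y) : 0 ≤ lyap M y := by
  unfold lyap
  split_ifs with h
  · exact mul_nonneg hy (by linarith)
  · positivity

lemma lyap_step (κ : Kernel ℕ ℕ) [IsMarkovKernel κ]
    (hmom1 : ∀ n, Integrable (fun m : ℕ => (m : ℝ)) (κ n))
    (hmart : ∀ a : ℕ, ∫ m, (m : ℝ) ∂(κ a) = a) {a : ℝ}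
    (ha : 0 < a) (hvar : ∀ n : ℕ, a * n ≤ ∫ m, (max ((n : ℝ) - m) 0) ^ 2 ∂(κ n))
    {M : ℝ} (hM : 0 < M) (x : ℕ) (hx : (x : ℝ) < M) :
    ∫⁻ y, ENNReal.ofReal (lyap M y) ∂(κ x) ≤
      ENNReal.ofReal (Real.exp (-(a / (2 * M)))) * ENNReal.ofReal (lyap M x) := by
  have hx0 : (0 : ℝ) ≤ x := by positivity
  have hint : Integrable (fun m : ℕ => (max ((x : ℝ) - m) 0) ^ 2) (κ x) := by
    refine (integrable_const ((x : ℝ) ^ 2)).mono' (Measurable.of_discrete.aestronglyMeasurable)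
      (ae_of_all _ fun m => ?_)
    rw [Real.norm_eq_abs, abs_of_nonneg (by positivity)]
    have : (0 : ℝ) ≤ m := by positivity
    gcongr
    exact max_le (by linarith) (by linarith)
  have hlin : Integrable (fun m : ℕ => lyap M x + (2 * M - 2 * x) * ((m : ℝ) - x)) (κ x) :=
    (integrable_const _).add (((hmom1 x).sub (integrable_const _)).const_mul _)
  have hrhs := hlin.sub hint
  have hli : Integrable (fun m : ℕ => lyap M m) (κ x) := by
    refine hrhs.mono' (Measurable.of_discrete.aestronglyMeasurable) (ae_of_all _ fun m => ?_)
    rw [Real.norm_eq_abs, abs_of_nonneg (lyap_nonneg (by positivity))]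
    exact lyap_le hx
  rw [← ofReal_integral_eq_lintegral_ofReal hli (ae_of_all _ fun m => lyap_nonneg (by positivity)),
    ← ENNReal.ofReal_mul (Real.exp_pos _).le]
  apply ENNReal.ofReal_le_ofReal
  have h1 : ∫ m, lyap M m ∂(κ x) ≤ lyap M x - a * x := by
    calc ∫ m, lyap M m ∂(κ x) ≤ ∫ m, ((lyap M x + (2 * M - 2 * x) * ((m : ℝ) - x)) -
          (max ((x : ℝ) - m) 0) ^ 2) ∂(κ x) := integral_mono hli hrhs fun m => lyap_le hx
      _ = lyap M x - ∫ m, (max ((x : ℝ) - m) 0) ^ 2 ∂(κ x) := by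
          have hi : Integrable (fun m : ℕ => (2 * M - 2 * x) * ((m : ℝ) - x)) (κ x) :=
            ((hmom1 x).sub (integrable_const _)).const_mul _
          rw [integral_sub hlin hint, integral_add (integrable_const _) hi, integral_const_mul,
            integral_sub (hmom1 x) (integrable_const _), hmart]
          simp
      _ ≤ _ := by linarith [hvar x]
  have h2 : lyap M x ≤ 2 * M * x := by
    unfold lyap; rw [if_pos hx.le]; nlinarith
  have h3 : lyap M x - a * x ≤ (1 - a / (2 * M)) * lyap M x := by
    have : a / (2 * M) * lyap M x ≤ a / (2 * M) * (2 * M * x) := by gcongr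
    have h4 : a / (2 * M) * (2 * M * x) = a * x := by field_simp
    linarith
  have h5 : 1 - a / (2 * M) ≤ Real.exp (-(a / (2 * M))) := by
    have := Real.add_one_le_exp (-(a / (2 * M)))
    linarith
  have h6 := mul_le_mul_of_nonneg_right h5 (lyap_nonneg (M := M) hx0)
  linarith

/-- it is exponentially unlikely that the chain started at `1`
reaches level `εn` but only after time `j·ε·n`: there are `c, C > 0` such that for
every `ε ∈ (0,1/2)`, for all `n` large enough and every `j ≥ 1`,
`P₁(∃ k, A_k ≥ εn, and A_k < εn for all k < jεn) ≤ C e^{-cj}/(εn)`. -/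
theorem late_hitting_time_bound
    (σ : ℝ) (hσ : 0 < σ) (κ : Kernel ℕ ℕ) [IsMarkovKernel κ]
    -- finite second moments
    (hmom : ∀ n : ℕ, Integrable (fun m : ℕ => (m : ℝ) ^ 2) (κ n))
    -- martingale property
    (hmart : ∀ a : ℕ, ∫ m, (m : ℝ) ∂(κ a) = a)
    -- variance lower bound
    (hlb : ∃ s : ℝ, 0 < s ∧ ∀ n : ℕ, 1 ≤ n → s ≤ ∫ m, ((m : ℝ) - n) ^ 2 ∂(κ n))
    -- variance asymptotics
    (hvar : Tendsto (fun n : ℕ => (∫ m, ((m : ℝ) - n) ^ 2 ∂(κ n)) / n) atTop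
      (nhds (σ ^ 2)))
    -- one-step CLT
    (hclt : ∀ f : BoundedContinuousFunction ℝ ℝ,
      Tendsto (fun n : ℕ => ∫ m, f (((m : ℝ) - n) / Real.sqrt n) ∂(κ n)) atTop
        (nhds (∫ x, f x ∂(gaussianReal 0 (Real.toNNReal (σ ^ 2))))))
    (P : Measure (ℕ → ℕ)) [IsProbabilityMeasure P] (hP : IsChainLaw κ 1 P) :
    ∃ c C : ℝ, 0 < c ∧ 0 < C ∧
      ∀ ε : ℝ, 0 < ε → ε < 1 / 2 → ∃ N : ℕ, ∀ n : ℕ, N ≤ n → ∀ j : ℕ, 1 ≤ j →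
        (P {ω | (∃ k : ℕ, ε * n ≤ (ω k : ℝ)) ∧
            ∀ k : ℕ, (k : ℝ) < j * ε * n → (ω k : ℝ) < ε * n}).toReal ≤
          C * Real.exp (-c * j) / (ε * n) := by
  have hmom1 : ∀ n, Integrable (fun m : ℕ => (m : ℝ)) (κ n) := by
    intro n
    refine (hmom n).mono' (Measurable.of_discrete.aestronglyMeasurable) (ae_of_all _ fun m => ?_)
    rw [Real.norm_natCast]
    exact_mod_cast Nat.le_self_pow two_ne_zero m
  have hmean : ∀ x : ℕ, ∫⁻ y, (y : ENNReal) ∂(κ x) ≤ x := by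
    intro x
    have h := ofReal_integral_eq_lintegral_ofReal (hmom1 x) (ae_of_all _ fun m => by positivity)
    rw [hmart] at h
    simp only [ENNReal.ofReal_natCast] at h
    exact h.symm.le
  obtain ⟨a, ha, hlv⟩ := lower_var σ hσ κ hmom hmart hlb hclt
  refine ⟨a / 2, 2 * Real.exp (a / 2), by positivity, by positivity, fun ε hε _ => ?_⟩
  obtain ⟨N, hN⟩ := exists_nat_gt (1 / ε)
  refine ⟨N, fun n hn j hj => ?_⟩
  have hM1 : 1 < ε * n := by
    have h1 : (N : ℝ) ≤ n := by exact_mod_cast hn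
    rw [div_lt_iff₀ hε] at hN
    nlinarith
  have hjM : (j : ℝ) * ε * n = j * (ε * n) := by ring
  simp only [hjM]
  generalize ε * (n : ℝ) = M at hM1 ⊢
  have hM : 0 < M := by linarith
  have hj1 : (1 : ℝ) ≤ j := by exact_mod_cast hj
  have hjM0 : 0 < (j : ℝ) * M := by positivity
  obtain ⟨k, hk⟩ : ∃ k, ⌈(j : ℝ) * M⌉₊ = k + 1 :=
    Nat.exists_eq_succ_of_ne_zero (Nat.ceil_pos.2 hjM0).ne'
  have hk1 : (j : ℝ) * M ≤ k + 1 := by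
    have := Nat.le_ceil ((j : ℝ) * M)
    rw [hk] at this
    exact_mod_cast this
  have hk2 : (k : ℝ) < j * M := by
    apply Nat.lt_ceil.1
    omega
  have hsub : {ω : ℕ → ℕ | (∃ k : ℕ, M ≤ (ω k : ℝ)) ∧
      ∀ k : ℕ, (k : ℝ) < j * M → (ω k : ℝ) < M} ⊆
      ⋃ l, stayBelow M k \ stayBelow M (k + l) := by
    rintro ω ⟨⟨i, hi⟩, h⟩
    refine Set.mem_iUnion.2 ⟨i, fun i' hi' => h i' ?_, fun hs => ?_⟩
    · have : (i' : ℝ) ≤ k := by exact_mod_cast hi'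
      linarith
    · exact absurd (hs i (by omega)) (not_lt.2 hi)
  have h1 := chain_exit_all hP M hmean k
  have h2 := chain_decay hP M (fun m => ENNReal.ofReal (lyap M m)) _
    (lyap_step κ hmom1 hmart ha hlv hM) k
  have h3 : ENNReal.ofReal M * ∫⁻ ω in stayBelow M k, (ω k : ENNReal) ∂P ≤
      ∫⁻ ω in stayBelow M k, ENNReal.ofReal (lyap M (ω k)) ∂P := by
    have hme : Measurable (fun ω : ℕ → ℕ => (ω k : ENNReal)) :=
      (Measurable.of_discrete (f := fun m : ℕ => (m : ENNReal))).comp (measurable_pi_apply k)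
    rw [← lintegral_const_mul _ hme]
    apply setLIntegral_mono' (measurableSet_stayBelow M k)
    intro ω hω
    have hlt : (ω k : ℝ) < M := hω k le_rfl
    have h0 : (0 : ℝ) ≤ ω k := by positivity
    rw [← ENNReal.ofReal_natCast, ← ENNReal.ofReal_mul hM.le]
    apply ENNReal.ofReal_le_ofReal
    unfold lyap
    rw [if_pos hlt.le]
    nlinarith
  have h4 : ENNReal.ofReal M * (ENNReal.ofReal M * P {ω : ℕ → ℕ | (∃ k : ℕ, M ≤ (ω k : ℝ)) ∧
      ∀ k : ℕ, (k : ℝ) < j * M → (ω k : ℝ) < M}) ≤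
      ENNReal.ofReal (Real.exp (-(a / (2 * M)))) ^ k * ENNReal.ofReal (lyap M (1 : ℕ)) := by
    refine le_trans ?_ (h3.trans h2)
    gcongr
    exact le_trans (by gcongr) h1
  generalize P {ω : ℕ → ℕ | (∃ k : ℕ, M ≤ (ω k : ℝ)) ∧
      ∀ k : ℕ, (k : ℝ) < j * M → (ω k : ℝ) < M} = p at h4 ⊢
  have h5 := ENNReal.toReal_mono (by finiteness) h4
  simp only [ENNReal.toReal_mul, ENNReal.toReal_pow, ENNReal.toReal_ofReal hM.le,
    ENNReal.toReal_ofReal (Real.exp_pos _).le, ENNReal.toReal_ofReal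
      (lyap_nonneg (M := M) (y := ((1 : ℕ) : ℝ)) (by positivity))] at h5
  have h6 : lyap M ((1 : ℕ) : ℝ) ≤ 2 * M := by
    unfold lyap; rw [Nat.cast_one, if_pos hM1.le]; linarith
  have h7 : Real.exp (-(a / (2 * M))) ^ k ≤ Real.exp (a / 2) * Real.exp (-(a / 2) * j) := by
    rw [← Real.exp_nat_mul, ← Real.exp_add]
    apply Real.exp_le_exp.2
    have e1 : a / (2 * M) * (j * M) = a / 2 * j := by field_simp
    have e2 : a / (2 * M) * (j * M) ≤ a / (2 * M) * (k + 1) := by gcongr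
    have e3 : a / (2 * M) ≤ a / 2 := by gcongr; linarith
    linarith
  rw [le_div_iff₀ hM]
  have h8 : M * (M * p.toReal) ≤ M * (2 * Real.exp (a / 2) * Real.exp (-(a / 2) * j)) := by
    calc _ ≤ _ := h5
      _ ≤ Real.exp (a / 2) * Real.exp (-(a / 2) * j) * (2 * M) := by
          gcongr
          exact lyap_nonneg (by positivity)
      _ = _ := by ring
  have h9 := le_of_mul_le_mul_left h8 hM
  linarith
end

section
/- Under the stated hypotheses on the kernel κ, for every fixed ε ∈ (0,1/2) one has, as n → ∞, ε n · P₁( there exists k ≥ 0 with A_k ≥ εn ) → 1; that is, the probability that the chain started at 1 ever reaches level εn is asymptotic to 1/(εn), saturating Doob's maximal inequality. -/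
open MeasureTheory ProbabilityTheory Filter

open scoped ENNReal

lemma coord_meas (k : ℕ) (p : ℕ → Prop) : MeasurableSet {ω : ℕ → ℕ | p (ω k)} := by
  have h : MeasurableSet {n : ℕ | p n} := (Set.to_countable _).measurableSet
  have h2 : Measurable (fun ω : ℕ → ℕ => ω k) := measurable_pi_apply k
  exact h2 h

lemma chain_step_s14 (κ : Kernel ℕ ℕ) (x : ℕ) (P : Measure (ℕ → ℕ)) (hP : IsChainLaw κ x P)
    (k : ℕ) (S : Set (Fin (k + 1) → ℕ)) (F : ℕ → ℝ≥0∞) :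
    ∫⁻ ω in {ω : ℕ → ℕ | (fun i : Fin (k + 1) => ω i.val) ∈ S}, F (ω (k + 1)) ∂P =
      ∫⁻ ω in {ω : ℕ → ℕ | (fun i : Fin (k + 1) => ω i.val) ∈ S}, (∫⁻ m, F m ∂(κ (ω k))) ∂P := by
  have hmeas : ∀ y : Fin (k + 1) → ℕ,
      MeasurableSet {ω : ℕ → ℕ | ∀ i : Fin (k + 1), ω i.val = y i} := by
    intro y
    rw [Set.ofPred_forall]
    refine MeasurableSet.iInter fun i => ?_
    exact measurableSet_eq_fun (measurable_pi_apply _) measurable_const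
  have hset : {ω : ℕ → ℕ | (fun i : Fin (k + 1) => ω i.val) ∈ S} =
      ⋃ y ∈ S, {ω : ℕ → ℕ | ∀ i : Fin (k + 1), ω i.val = y i} := by
    ext ω
    simp only [Set.mem_ofPred_eq, Set.mem_iUnion, exists_prop]
    constructor
    · intro h
      exact ⟨_, h, fun i => rfl⟩
    · rintro ⟨y, hy, h⟩
      have : (fun i : Fin (k + 1) => ω i.val) = y := funext h
      rwa [this]
  have hdisj : S.PairwiseDisjoint
      (fun y => {ω : ℕ → ℕ | ∀ i : Fin (k + 1), ω i.val = y i}) := by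
    intro y _ z _ hyz
    refine Set.disjoint_left.2 fun ω h1 h2 => hyz ?_
    funext i
    exact (h1 i).symm.trans (h2 i)
  rw [hset, lintegral_biUnion S.to_countable (fun y _ => hmeas y) hdisj,
    lintegral_biUnion S.to_countable (fun y _ => hmeas y) hdisj]
  refine tsum_congr fun y => ?_
  obtain ⟨y, hy⟩ := y
  simp only
  have hL : ∫⁻ ω in {ω : ℕ → ℕ | ∀ i : Fin (k + 1), ω i.val = y i}, F (ω (k + 1)) ∂P =
      ∑' m, F m * (P {ω : ℕ → ℕ | ∀ i : Fin (k + 1), ω i.val = y i} * κ (y (Fin.last k)) {m}) := by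
    rw [← lintegral_map (f := F) (g := fun ω : ℕ → ℕ => ω (k + 1)) (measurable_of_countable F)
      (measurable_pi_apply _), lintegral_countable']
    refine tsum_congr fun m => ?_
    congr 1
    have hproj : Measurable (fun ω : ℕ → ℕ => ω (k + 1)) := measurable_pi_apply _
    rw [Measure.map_apply hproj (measurableSet_singleton m),
      Measure.restrict_apply (hproj (measurableSet_singleton m))]
    have h1 : (fun ω : ℕ → ℕ => ω (k + 1)) ⁻¹' {m} ∩
        {ω : ℕ → ℕ | ∀ i : Fin (k + 1), ω i.val = y i} =
        {ω : ℕ → ℕ | ∀ i : Fin (k + 1 + 1), ω i.val = (Fin.snoc y m : Fin (k + 1 + 1) → ℕ) i} := by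
      ext ω
      simp [Fin.forall_fin_succ', and_comm]
    rw [h1, hP (k + 1), hP k, Fin.prod_univ_castSucc, ← mul_assoc]
    have h0 : (Fin.snoc y m : Fin (k + 1 + 1) → ℕ) 0 = y 0 := by
      have := Fin.snoc_castSucc (α := fun _ => ℕ) m y 0
      simpa using this
    have h2 : ∀ i : Fin k, (Fin.snoc y m : Fin (k + 1 + 1) → ℕ) i.castSucc.succ = y i.succ := by
      intro i
      have := Fin.snoc_castSucc (α := fun _ => ℕ) m y i.succ
      rw [← this]
      rfl
    rw [h0]
    simp only [Fin.snoc_castSucc, h2, Fin.succ_last, Fin.snoc_last]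
  have hR : ∫⁻ ω in {ω : ℕ → ℕ | ∀ i : Fin (k + 1), ω i.val = y i},
      (∫⁻ m, F m ∂(κ (ω k))) ∂P =
      ∫⁻ ω in {ω : ℕ → ℕ | ∀ i : Fin (k + 1), ω i.val = y i},
      (∫⁻ m, F m ∂(κ (y (Fin.last k)))) ∂P := by
    refine setLIntegral_congr_fun (hmeas y) fun ω hω => ?_
    have := hω (Fin.last k)
    simp only [Fin.val_last] at this
    simp only [this]
  rw [hL, hR, lintegral_const, lintegral_countable', ← ENNReal.tsum_mul_right]
  refine tsum_congr fun m => ?_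
  rw [Measure.restrict_apply MeasurableSet.univ, Set.univ_inter]
  ring

/-- Not having reached level `L` by time `k`. -/
def belowSet (L : ℝ) (k : ℕ) : Set (ℕ → ℕ) := {ω | ∀ i : Fin (k + 1), (ω i.val : ℝ) < L}

lemma belowSet_meas (L : ℝ) (k : ℕ) : MeasurableSet (belowSet L k) := by
  unfold belowSet
  rw [Set.ofPred_forall]
  refine MeasurableSet.iInter fun i => ?_
  exact coord_meas i.val (fun n => (n : ℝ) < L)

lemma belowSet_succ (L : ℝ) (k : ℕ) :
    belowSet L (k + 1) = belowSet L k ∩ {ω | (ω (k + 1) : ℝ) < L} := by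
  ext ω
  simp [belowSet, Fin.forall_fin_succ' (n := k + 1)]

lemma below_step (κ : Kernel ℕ ℕ) (x : ℕ) (P : Measure (ℕ → ℕ)) (hP : IsChainLaw κ x P)
    (L : ℝ) (k : ℕ) (F : ℕ → ℝ≥0∞) :
    ∫⁻ ω in belowSet L k, F (ω (k + 1)) ∂P =
      ∫⁻ ω in belowSet L k, (∫⁻ m, F m ∂(κ (ω k))) ∂P :=
  chain_step_s14 κ x P hP k {y | ∀ i, (y i : ℝ) < L} F

lemma compl_succ (P : Measure (ℕ → ℕ)) (L : ℝ) (k : ℕ) :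
    P (belowSet L (k + 1))ᶜ = P (belowSet L k)ᶜ +
      P (belowSet L k ∩ {ω | L ≤ (ω (k + 1) : ℝ)}) := by
  rw [← measure_union]
  · congr 1
    rw [belowSet_succ]
    ext ω
    by_cases h : ω ∈ belowSet L k <;> simp [h]
  · exact Set.disjoint_left.2 fun ω h1 h2 => h1 h2.1
  · exact (belowSet_meas L k).inter
      (coord_meas (k + 1) (fun n => L ≤ (n : ℝ)))

lemma split_succ (P : Measure (ℕ → ℕ)) (L : ℝ) (k : ℕ) (F : ℕ → ℝ≥0∞) :
    ∫⁻ ω in belowSet L k, F (ω (k + 1)) ∂P =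
      ∫⁻ ω in belowSet L (k + 1), F (ω (k + 1)) ∂P +
      ∫⁻ ω in belowSet L k ∩ {ω | L ≤ (ω (k + 1) : ℝ)}, F (ω (k + 1)) ∂P := by
  have hm : MeasurableSet {ω : ℕ → ℕ | (ω (k + 1) : ℝ) < L} :=
    coord_meas (k + 1) (fun n => (n : ℝ) < L)
  rw [belowSet_succ, ← lintegral_inter_add_sdiff _ _ hm]
  congr 3
  ext ω
  simp

lemma init_eq (κ : Kernel ℕ ℕ) (P : Measure (ℕ → ℕ)) [IsProbabilityMeasure P]
    (hP : IsChainLaw κ 1 P) (L : ℝ) (hL : 1 < L) (F : ℕ → ℝ≥0∞) :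
    ∫⁻ ω in belowSet L 0, F (ω 0) ∂P = F 1 := by
  have h := hP 0 (fun _ => 1)
  simp only [↓reduceIte, Finset.univ_eq_empty, Finset.prod_empty, mul_one] at h
  have hae : ∀ᵐ ω ∂P, ω 0 = 1 := by
    have : P {ω : ℕ → ℕ | ω 0 = 1} = 1 := by
      rw [← h]; congr 1; ext ω; simp
    exact (mem_ae_iff_prob_eq_one (coord_meas 0 (fun n => n = 1))).2 this
  have h1 : ∫⁻ ω in belowSet L 0, F (ω 0) ∂P = ∫⁻ ω, F (ω 0) ∂P := by
    rw [Measure.restrict_eq_self_of_ae_mem]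
    filter_upwards [hae] with ω h
    intro i
    have : i.val = 0 := by omega
    rw [this, h]
    simpa using hL
  rw [h1, lintegral_congr_ae (g := fun _ => F 1) (by filter_upwards [hae] with ω h; simp [h])]
  simp

lemma hit_eq (L : ℝ) : {ω : ℕ → ℕ | ∃ k : ℕ, L ≤ (ω k : ℝ)} = ⋃ k, (belowSet L k)ᶜ := by
  ext ω
  simp only [belowSet, Set.mem_ofPred_eq, Set.mem_iUnion, Set.mem_compl_iff, not_forall, not_lt]
  constructor
  · rintro ⟨k, h⟩
    exact ⟨k, Fin.last k, by simpa using h⟩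
  · rintro ⟨k, i, h⟩
    exact ⟨_, h⟩

lemma upper_bound (κ : Kernel ℕ ℕ) (P : Measure (ℕ → ℕ)) [IsProbabilityMeasure P]
    (hP : IsChainLaw κ 1 P) (hm : ∀ a : ℕ, ∫⁻ m, (m : ℝ≥0∞) ∂(κ a) = a)
    (L : ℝ) (hL : 1 < L) :
    ENNReal.ofReal L * P {ω : ℕ → ℕ | ∃ k : ℕ, L ≤ (ω k : ℝ)} ≤ 1 := by
  have hind : ∀ k, ∫⁻ ω in belowSet L k, (ω k : ℝ≥0∞) ∂P +
      ENNReal.ofReal L * P (belowSet L k)ᶜ ≤ 1 := by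
    intro k
    induction k with
    | zero =>
      have h0 := init_eq κ P hP L hL (fun n => (n : ℝ≥0∞))
      have h1 := init_eq κ P hP L hL (fun n => 1)
      have h2 : P (belowSet L 0)ᶜ = 0 := by
        rw [prob_compl_eq_zero_iff (belowSet_meas L 0)]
        simpa using h1
      rw [h0, h2]; simp
    | succ k ih =>
      refine le_trans ?_ ih
      rw [compl_succ, mul_add]
      have hs := below_step κ 1 P hP L k (fun n => (n : ℝ≥0∞))
      rw [split_succ] at hs
      simp only [hm] at hs
      rw [← hs]
      have h3 : ENNReal.ofReal L * P (belowSet L k ∩ {ω | L ≤ (ω (k + 1) : ℝ)}) ≤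
          ∫⁻ ω in belowSet L k ∩ {ω | L ≤ (ω (k + 1) : ℝ)}, (ω (k + 1) : ℝ≥0∞) ∂P := by
        rw [← setLIntegral_const]
        refine setLIntegral_mono' ((belowSet_meas L k).inter
          (coord_meas (k + 1) (fun n => L ≤ (n : ℝ)))) fun ω hω => ?_
        rw [← ENNReal.ofReal_natCast]
        exact ENNReal.ofReal_le_ofReal hω.2
      calc _ = ∫⁻ ω in belowSet L (k + 1), (ω (k + 1) : ℝ≥0∞) ∂P +
            ENNReal.ofReal L * P (belowSet L k ∩ {ω | L ≤ (ω (k + 1) : ℝ)}) +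
            ENNReal.ofReal L * P (belowSet L k)ᶜ := by ring
        _ ≤ _ := by gcongr
  rw [hit_eq]
  have hmono : Monotone fun k => (belowSet L k)ᶜ := by
    refine monotone_nat_of_le_succ fun k => ?_
    rw [belowSet_succ]
    exact Set.compl_subset_compl.2 Set.inter_subset_left
  rw [hmono.measure_iUnion, ENNReal.mul_iSup]
  exact iSup_le fun k => le_trans le_add_self (hind k)

lemma lower_bound (κ : Kernel ℕ ℕ) (P : Measure (ℕ → ℕ)) [IsProbabilityMeasure P]
    (hP : IsChainLaw κ 1 P) (L : ℝ) (hL : 1 < L) (f : ℕ → ℝ≥0∞) (M c : ℝ≥0∞)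
    (hf : ∀ n, f n ≤ M) (hf0 : f 0 = 0) (hM : M ≠ ∞) (hc : c ≠ 0)
    (hstep : ∀ a : ℕ, 1 ≤ a → (a : ℝ) < L → f a + c ≤ ∫⁻ m, f m ∂(κ a)) :
    f 1 ≤ M * P {ω : ℕ → ℕ | ∃ k : ℕ, L ≤ (ω k : ℝ)} := by
  set D : ℕ → Set (ℕ → ℕ) := fun k => belowSet L k ∩ {ω | 1 ≤ ω k} with hD
  have hpos : ∀ k, MeasurableSet {ω : ℕ → ℕ | 1 ≤ ω k} := fun k =>
    coord_meas k (fun n => 1 ≤ n)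
  have hDm : ∀ k, MeasurableSet (D k) := fun k => (belowSet_meas L k).inter (hpos k)
  have hind : ∀ k, f 1 + ∑ j ∈ Finset.range k, c * P (D j) ≤
      ∫⁻ ω in belowSet L k, f (ω k) ∂P + M * P (belowSet L k)ᶜ := by
    intro k
    induction k with
    | zero =>
      rw [init_eq κ P hP L hL f]; simp
    | succ k ih =>
      rw [Finset.sum_range_succ, ← add_assoc]
      have hs := below_step κ 1 P hP L k f
      rw [split_succ] at hs
      have h1 : ∫⁻ ω in belowSet L k, f (ω k) ∂P + c * P (D k) ≤
          ∫⁻ ω in belowSet L k, (∫⁻ m, f m ∂(κ (ω k))) ∂P := by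
        have : c * P (D k) = ∫⁻ ω in belowSet L k,
            ({ω : ℕ → ℕ | 1 ≤ ω k}).indicator (fun _ => c) ω ∂P := by
          rw [lintegral_indicator (hpos k), Measure.restrict_restrict (hpos k), setLIntegral_const,
            Set.inter_comm]
        rw [this, ← lintegral_add_right _ (measurable_const.indicator (hpos k))]
        refine setLIntegral_mono' (belowSet_meas L k) fun ω hω => ?_
        by_cases h : 1 ≤ ω k
        · rw [Set.indicator_of_mem (by exact h)]
          exact hstep _ h (by simpa using hω (Fin.last k))
        · rw [Set.indicator_of_notMem (by exact h)]
          have : ω k = 0 := by omega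
          simp [this, hf0]
      have h3 : ∫⁻ ω in belowSet L k ∩ {ω | L ≤ (ω (k + 1) : ℝ)}, f (ω (k + 1)) ∂P ≤
          M * P (belowSet L k ∩ {ω | L ≤ (ω (k + 1) : ℝ)}) := by
        rw [← setLIntegral_const]
        exact lintegral_mono fun ω => hf _
      rw [compl_succ, mul_add]
      calc _ ≤ (∫⁻ ω in belowSet L k, f (ω k) ∂P + M * P (belowSet L k)ᶜ) + c * P (D k) := by
            gcongr
        _ = (∫⁻ ω in belowSet L k, f (ω k) ∂P + c * P (D k)) + M * P (belowSet L k)ᶜ := by ring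
        _ ≤ (∫⁻ ω in belowSet L (k + 1), f (ω (k + 1)) ∂P +
            M * P (belowSet L k ∩ {ω | L ≤ (ω (k + 1) : ℝ)})) + M * P (belowSet L k)ᶜ := by
            refine add_le_add ((h1.trans_eq hs.symm).trans (add_le_add le_rfl h3)) le_rfl
        _ = _ := by ring
  have hE : ∀ k, ∫⁻ ω in belowSet L k, f (ω k) ∂P ≤ M * P (D k) := by
    intro k
    have : M * P (D k) = ∫⁻ ω in belowSet L k,
        ({ω : ℕ → ℕ | 1 ≤ ω k}).indicator (fun _ => M) ω ∂P := by
      rw [lintegral_indicator (hpos k), Measure.restrict_restrict (hpos k), setLIntegral_const,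
        Set.inter_comm]
    rw [this]
    refine lintegral_mono fun ω => ?_
    by_cases h : 1 ≤ ω k
    · rw [Set.indicator_of_mem (by exact h)]
      exact hf _
    · have : ω k = 0 := by omega
      simp [this, hf0]
  have hsum : ∑' j, c * P (D j) ≤ M + M := by
    refine ENNReal.tsum_le_of_sum_range_le fun k => ?_
    refine le_add_self.trans ((hind k).trans ?_)
    refine add_le_add ((hE k).trans ?_) ?_
    · exact mul_le_of_le_one_right' prob_le_one
    · exact mul_le_of_le_one_right' prob_le_one
  have hPD : Tendsto (fun k => P (D k)) atTop (nhds 0) := by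
    rw [ENNReal.tsum_mul_left] at hsum
    refine ENNReal.tendsto_atTop_zero_of_tsum_ne_top ?_
    intro htop
    rw [htop, ENNReal.mul_top hc] at hsum
    exact (ENNReal.add_ne_top.2 ⟨hM, hM⟩) (top_le_iff.1 hsum)
  have hlim : Tendsto (fun k => M * P (D k) + M * P {ω : ℕ → ℕ | ∃ k : ℕ, L ≤ (ω k : ℝ)}) atTop
      (nhds (M * 0 + M * P {ω : ℕ → ℕ | ∃ k : ℕ, L ≤ (ω k : ℝ)})) :=
    (ENNReal.Tendsto.const_mul hPD (Or.inr hM)).add tendsto_const_nhds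
  rw [mul_zero, zero_add] at hlim
  refine ge_of_tendsto' hlim fun k => ?_
  refine le_self_add.trans ((hind k).trans (add_le_add (hE k) ?_))
  gcongr
  rw [hit_eq]
  exact Set.subset_iUnion (fun k => (belowSet L k)ᶜ) k

lemma gauss_sq (σ : ℝ) : Integrable (fun x : ℝ => x ^ 2) (gaussianReal 0 (Real.toNNReal (σ ^ 2))) ∧
    ∫ x, x ^ 2 ∂(gaussianReal 0 (Real.toNNReal (σ ^ 2))) = σ ^ 2 := by
  have hm : MemLp (id : ℝ → ℝ) 2 (gaussianReal 0 (Real.toNNReal (σ ^ 2))) :=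
    memLp_id_gaussianReal 2
  refine ⟨hm.integrable_sq, ?_⟩
  have h1 := variance_id_gaussianReal (μ := 0) (v := Real.toNNReal (σ ^ 2))
  rw [variance_eq_integral measurable_id.aemeasurable] at h1
  simp only [id, integral_id_gaussianReal, sub_zero] at h1
  rw [h1, Real.coe_toNNReal _ (sq_nonneg σ)]

/-- truncated square -/
noncomputable def truncSq (K : ℝ) : BoundedContinuousFunction ℝ ℝ :=
  BoundedContinuousFunction.ofNormedAddCommGroup (fun x => min (x ^ 2) (K ^ 2)) (by fun_prop)
    (K ^ 2) (fun x => by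
      rw [Real.norm_of_nonneg (by positivity)]
      exact min_le_right _ _)

lemma truncSq_apply (K x : ℝ) : truncSq K x = min (x ^ 2) (K ^ 2) := rfl

lemma exists_trunc (σ : ℝ) (η : ℝ) (hη : 0 < η) : ∃ K : ℝ, 0 < K ∧
    σ ^ 2 - η < ∫ x, truncSq K x ∂(gaussianReal 0 (Real.toNNReal (σ ^ 2))) := by
  obtain ⟨hi, he⟩ := gauss_sq σ
  have h : Tendsto (fun k : ℕ => ∫ x, truncSq (k : ℝ) x ∂(gaussianReal 0 (Real.toNNReal (σ ^ 2))))
      atTop (nhds (∫ x, x ^ 2 ∂(gaussianReal 0 (Real.toNNReal (σ ^ 2))))) := by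
    refine tendsto_integral_of_dominated_convergence (fun x => x ^ 2) (fun k => ?_) hi
      (fun k => ?_) ?_
    · exact (truncSq k).continuous.aestronglyMeasurable
    · refine Eventually.of_forall fun x => ?_
      rw [truncSq_apply, Real.norm_of_nonneg (by positivity)]
      exact min_le_left _ _
    · refine Eventually.of_forall fun x => ?_
      obtain ⟨N, hN⟩ := exists_nat_ge |x|
      refine tendsto_const_nhds.congr' ?_
      filter_upwards [eventually_ge_atTop N] with k hk
      rw [truncSq_apply, min_eq_left]
      have : |x| ≤ (k : ℝ) := hN.trans (by exact_mod_cast hk)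
      exact sq_le_sq' (by linarith [neg_abs_le x]) (by linarith [le_abs_self x])
  rw [he] at h
  obtain ⟨k, h1, h2⟩ := ((h.eventually (lt_mem_nhds (by linarith : σ ^ 2 - η < σ ^ 2))).and
    (eventually_gt_atTop 0)).exists
  exact ⟨k, by exact_mod_cast h2, h1⟩

lemma int_sub_sq (κ : Kernel ℕ ℕ) [IsMarkovKernel κ]
    (hmom : ∀ n : ℕ, Integrable (fun m : ℕ => (m : ℝ) ^ 2) (κ n)) (a : ℕ) (b : ℝ) :
    Integrable (fun m : ℕ => ((m : ℝ) - b) ^ 2) (κ a) := by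
  have h : MemLp (fun m : ℕ => (m : ℝ)) 2 (κ a) :=
    (memLp_two_iff_integrable_sq (measurable_of_countable _).aestronglyMeasurable).2 (hmom a)
  exact (h.sub (memLp_const b)).integrable_sq

/-- uniform integrability for large starting points -/
lemma tail_large (σ : ℝ) (κ : Kernel ℕ ℕ) [IsMarkovKernel κ]
    (hmom : ∀ n : ℕ, Integrable (fun m : ℕ => (m : ℝ) ^ 2) (κ n))
    (hvar : Tendsto (fun n : ℕ => (∫ m, ((m : ℝ) - n) ^ 2 ∂(κ n)) / n) atTop
      (nhds (σ ^ 2)))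
    (hclt : ∀ f : BoundedContinuousFunction ℝ ℝ,
      Tendsto (fun n : ℕ => ∫ m, f (((m : ℝ) - n) / Real.sqrt n) ∂(κ n)) atTop
        (nhds (∫ x, f x ∂(gaussianReal 0 (Real.toNNReal (σ ^ 2))))))
    (η : ℝ) (hη : 0 < η) :
    ∃ K : ℝ, 0 < K ∧ ∃ N : ℕ, ∀ a : ℕ, N ≤ a →
      ∫ m, {m : ℕ | K * Real.sqrt a ≤ (m : ℝ) - a}.indicator (fun m : ℕ => ((m : ℝ) - a) ^ 2) m
        ∂(κ a) ≤ η * a := by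
  obtain ⟨K, hK, hK2⟩ := exists_trunc σ (η / 4) (by positivity)
  have e1 := (hclt (truncSq K)).eventually (lt_mem_nhds hK2)
  have e2 := hvar.eventually (gt_mem_nhds (by linarith : σ ^ 2 < σ ^ 2 + η / 4))
  obtain ⟨N, hN⟩ := eventually_atTop.1 ((e1.and e2).and (eventually_gt_atTop 0))
  refine ⟨2 * K, by positivity, N, fun a ha => ?_⟩
  obtain ⟨⟨h1, h2⟩, h3⟩ := hN a ha
  have ha0 : (0 : ℝ) < a := by exact_mod_cast h3
  have hi := int_sub_sq κ hmom a a
  have hT : Integrable (fun m : ℕ => truncSq K (((m : ℝ) - a) / Real.sqrt a)) (κ a) := by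
    refine Integrable.of_bound (measurable_of_countable _).aestronglyMeasurable (K ^ 2)
      (Eventually.of_forall fun m => ?_)
    rw [truncSq_apply, Real.norm_of_nonneg (by positivity)]
    exact min_le_right _ _
  rw [div_lt_iff₀ ha0] at h2
  calc _ ≤ ∫ m : ℕ, (4 / 3) * (((m : ℝ) - a) ^ 2 - a * truncSq K (((m : ℝ) - a) / Real.sqrt a))
        ∂(κ a) := by
        refine integral_mono (hi.indicator (Set.to_countable _).measurableSet)
          ((hi.sub (hT.const_mul _)).const_mul _) fun m => ?_
        have hq : (a : ℝ) * truncSq K (((m : ℝ) - a) / Real.sqrt a) =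
            min (((m : ℝ) - a) ^ 2) (a * K ^ 2) := by
          rw [truncSq_apply, div_pow, Real.sq_sqrt ha0.le, mul_min_of_nonneg _ _ ha0.le]
          congr 1
          field_simp
        simp only [hq]
        by_cases h : 2 * K * Real.sqrt a ≤ (m : ℝ) - a
        · rw [Set.indicator_of_mem (by exact h)]
          have h5 : (2 * K * Real.sqrt a) ^ 2 ≤ ((m : ℝ) - a) ^ 2 :=
            pow_le_pow_left₀ (by positivity) h 2
          rw [mul_pow, Real.sq_sqrt ha0.le] at h5
          have := min_le_right (((m : ℝ) - a) ^ 2) (a * K ^ 2)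
          nlinarith
        · rw [Set.indicator_of_notMem (by exact h)]
          have := min_le_left (((m : ℝ) - a) ^ 2) (a * K ^ 2)
          linarith
    _ = (4 / 3) * (∫ m : ℕ, ((m : ℝ) - a) ^ 2 ∂(κ a) -
          a * ∫ m : ℕ, truncSq K (((m : ℝ) - a) / Real.sqrt a) ∂(κ a)) := by
        rw [integral_const_mul, integral_sub hi (hT.const_mul _), integral_const_mul]
    _ ≤ η * a := by nlinarith

lemma tail_small (κ : Kernel ℕ ℕ) [IsMarkovKernel κ]
    (hmom : ∀ n : ℕ, Integrable (fun m : ℕ => (m : ℝ) ^ 2) (κ n))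
    (θ : ℝ) (hθ : 0 < θ) (a : ℕ) (η : ℝ) (hη : 0 < η) :
    ∀ᶠ L : ℝ in atTop,
      ∫ m, {m : ℕ | θ * L ≤ (m : ℝ) - a}.indicator (fun m : ℕ => ((m : ℝ) - a) ^ 2) m
        ∂(κ a) ≤ η := by
  have hi := int_sub_sq κ hmom a a
  have h : Tendsto (fun L : ℝ => ∫ m, {m : ℕ | θ * L ≤ (m : ℝ) - a}.indicator
      (fun m : ℕ => ((m : ℝ) - a) ^ 2) m ∂(κ a)) atTop (nhds (∫ m : ℕ, (0 : ℝ) ∂(κ a))) := by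
    refine tendsto_integral_filter_of_dominated_convergence (fun m : ℕ => ((m : ℝ) - a) ^ 2)
      (Eventually.of_forall fun L => (measurable_of_countable _).aestronglyMeasurable)
      (Eventually.of_forall fun L => Eventually.of_forall fun m => ?_) hi
      (Eventually.of_forall fun m => ?_)
    · refine (norm_indicator_le_norm_self _ _).trans ?_
      rw [Real.norm_of_nonneg (sq_nonneg _)]
    · refine tendsto_const_nhds.congr' ?_
      filter_upwards [eventually_gt_atTop (((m : ℝ) - a) / θ)] with L hL
      rw [div_lt_iff₀ hθ] at hL
      rw [Set.indicator_of_notMem]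
      simp only [Set.mem_ofPred_eq, not_le]
      linarith
  rw [integral_zero] at h
  filter_upwards [h.eventually (gt_mem_nhds hη)] with L hL using hL.le

lemma tail_key (σ : ℝ) (hσ : 0 < σ) (κ : Kernel ℕ ℕ) [IsMarkovKernel κ]
    (hmom : ∀ n : ℕ, Integrable (fun m : ℕ => (m : ℝ) ^ 2) (κ n))
    (hlb : ∃ s : ℝ, 0 < s ∧ ∀ n : ℕ, 1 ≤ n → s ≤ ∫ m, ((m : ℝ) - n) ^ 2 ∂(κ n))
    (hvar : Tendsto (fun n : ℕ => (∫ m, ((m : ℝ) - n) ^ 2 ∂(κ n)) / n) atTop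
      (nhds (σ ^ 2)))
    (hclt : ∀ f : BoundedContinuousFunction ℝ ℝ,
      Tendsto (fun n : ℕ => ∫ m, f (((m : ℝ) - n) / Real.sqrt n) ∂(κ n)) atTop
        (nhds (∫ x, f x ∂(gaussianReal 0 (Real.toNNReal (σ ^ 2))))))
    (θ : ℝ) (hθ : 0 < θ) (η : ℝ) (hη : 0 < η) :
    ∀ᶠ L : ℝ in atTop, ∀ a : ℕ, 1 ≤ a → (a : ℝ) < L →
      ∫ m, {m : ℕ | θ * L ≤ (m : ℝ) - a}.indicator (fun m : ℕ => ((m : ℝ) - a) ^ 2) m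
        ∂(κ a) ≤ η * ∫ m, ((m : ℝ) - a) ^ 2 ∂(κ a) := by
  obtain ⟨s, hs, hlb⟩ := hlb
  obtain ⟨K, hK, N1, hN1⟩ := tail_large σ κ hmom hvar hclt (η * (σ ^ 2 / 2)) (by positivity)
  have hσ2 : 0 < σ ^ 2 := by positivity
  obtain ⟨N2, hN2⟩ := eventually_atTop.1
    (hvar.eventually (lt_mem_nhds (by linarith : σ ^ 2 / 2 < σ ^ 2)))
  have hfin : ∀ᶠ L : ℝ in atTop, ∀ a ∈ Finset.range (max N1 N2),
      ∫ m, {m : ℕ | θ * L ≤ (m : ℝ) - a}.indicator (fun m : ℕ => ((m : ℝ) - a) ^ 2) m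
        ∂(κ a) ≤ η * s :=
    (eventually_all_finset _).2 fun a _ => tail_small κ hmom θ hθ a (η * s) (by positivity)
  filter_upwards [hfin, eventually_ge_atTop ((K / θ) ^ 2)] with L h1 h2 a ha haL
  have ha0 : (0 : ℝ) < a := by exact_mod_cast ha
  by_cases hcase : a < max N1 N2
  · refine (h1 a (Finset.mem_range.2 hcase)).trans ?_
    have := hlb a ha
    gcongr
  · have hge : max N1 N2 ≤ a := not_lt.1 hcase
    have hv := hN2 a ((le_max_right _ _).trans hge)
    rw [lt_div_iff₀ ha0] at hv
    have hi := int_sub_sq κ hmom a a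
    have hL0 : 0 < L := ha0.trans haL
    have hle : K * Real.sqrt a ≤ θ * L := by
      have h3 : K / θ ≤ Real.sqrt L := Real.le_sqrt_of_sq_le h2
      rw [div_le_iff₀ hθ] at h3
      have h4 : Real.sqrt a ≤ Real.sqrt L := Real.sqrt_le_sqrt haL.le
      have h5 := Real.mul_self_sqrt hL0.le
      calc K * Real.sqrt a ≤ (Real.sqrt L * θ) * Real.sqrt L := by gcongr
        _ = θ * (Real.sqrt L * Real.sqrt L) := by ring
        _ = θ * L := by rw [h5]
    calc _ ≤ ∫ m, {m : ℕ | K * Real.sqrt a ≤ (m : ℝ) - a}.indicator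
          (fun m : ℕ => ((m : ℝ) - a) ^ 2) m ∂(κ a) := by
          refine integral_mono (hi.indicator (Set.to_countable _).measurableSet)
            (hi.indicator (Set.to_countable _).measurableSet) fun m => ?_
          refine Set.indicator_le_indicator_of_subset ?_ (fun m => sq_nonneg _) m
          intro m hm
          exact hle.trans hm
      _ ≤ η * (σ ^ 2 / 2) * a := hN1 a ((le_max_left _ _).trans hge)
      _ ≤ _ := by rw [mul_assoc]; gcongr

/-- pointwise inequality for the test function `h (min x M)`,
`h x = (1-θ) x + θ x² / M`, `M = (1+θ) L`. -/
lemma test_pointwise (θ L a m : ℝ) (hθ : 0 < θ) (hθ1 : θ ≤ 1) (hL : 0 < L) (ha : 0 < a)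
    (haL : a < L) (hm : 0 ≤ m) (I : ℝ) (hI0 : 0 ≤ I)
    (hI : θ * L ≤ m - a → I = (m - a) ^ 2) :
    ((1 - θ) * a + θ * a ^ 2 / ((1 + θ) * L)) +
      ((1 - θ) + 2 * θ * a / ((1 + θ) * L)) * (m - a) + θ / (2 * L) * (m - a) ^ 2
      - 3 / (θ * L) * I ≤
    (1 - θ) * min m ((1 + θ) * L) + θ * (min m ((1 + θ) * L)) ^ 2 / ((1 + θ) * L) := by
  set M := (1 + θ) * L with hM
  have hMpos : 0 < M := by positivity
  have hM2 : M ≤ 2 * L := by nlinarith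
  have h1 : θ / (2 * L) ≤ θ / M := by gcongr
  have h2 : θ / (2 * L) * (m - a) ^ 2 ≤ θ / M * (m - a) ^ 2 := by gcongr
  have h3 : ((1 - θ) * a + θ * a ^ 2 / M) + ((1 - θ) + 2 * θ * a / M) * (m - a)
      + θ / M * (m - a) ^ 2 = (1 - θ) * m + θ * m ^ 2 / M := by
    field_simp
    ring
  rcases le_total m M with hmM | hmM
  · rw [min_eq_left hmM]
    have : 0 ≤ 3 / (θ * L) * I := by positivity
    linarith
  · rw [min_eq_right hmM]
    have ht : θ * L ≤ m - a := by nlinarith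
    rw [hI ht]
    have hθL : 0 < θ * L := by positivity
    set t := m - a with htdef
    have h4 : t ≤ t ^ 2 / (θ * L) := by
      rw [le_div_iff₀ hθL]; nlinarith
    have h5 : (1 - θ) * m + θ * m ^ 2 / M - ((1 - θ) * M + θ * M ^ 2 / M) =
        (m - M) * (1 + θ * (m / M)) := by
      field_simp
      ring
    have h6 : m / M ≤ 1 + t / M := by
      rw [div_le_iff₀ hMpos, add_mul, div_mul_cancel₀ _ hMpos.ne']
      nlinarith
    have h7 : m - M ≤ t := by nlinarith
    have h8 : t ^ 2 / M ≤ t ^ 2 / (θ * L) := by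
      gcongr
      nlinarith
    have ht0 : 0 ≤ t := hθL.le.trans ht
    have h9 : (m - M) * (1 + θ * (m / M)) ≤ t * (1 + 1 * (1 + t / M)) := by
      gcongr
    have h10 : t * (1 + 1 * (1 + t / M)) = 2 * t + t ^ 2 / M := by ring
    have h11 : 3 / (θ * L) * t ^ 2 = 3 * (t ^ 2 / (θ * L)) := by ring
    linarith

lemma key_lower (σ : ℝ) (hσ : 0 < σ) (κ : Kernel ℕ ℕ) [IsMarkovKernel κ]
    (hmom : ∀ n : ℕ, Integrable (fun m : ℕ => (m : ℝ) ^ 2) (κ n))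
    (hmart : ∀ a : ℕ, ∫ m, (m : ℝ) ∂(κ a) = a)
    (hlb : ∃ s : ℝ, 0 < s ∧ ∀ n : ℕ, 1 ≤ n → s ≤ ∫ m, ((m : ℝ) - n) ^ 2 ∂(κ n))
    (hvar : Tendsto (fun n : ℕ => (∫ m, ((m : ℝ) - n) ^ 2 ∂(κ n)) / n) atTop
      (nhds (σ ^ 2)))
    (hclt : ∀ f : BoundedContinuousFunction ℝ ℝ,
      Tendsto (fun n : ℕ => ∫ m, f (((m : ℝ) - n) / Real.sqrt n) ∂(κ n)) atTop
        (nhds (∫ x, f x ∂(gaussianReal 0 (Real.toNNReal (σ ^ 2))))))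
    (P : Measure (ℕ → ℕ)) [IsProbabilityMeasure P] (hP : IsChainLaw κ 1 P)
    (θ : ℝ) (hθ : 0 < θ) (hθ1 : θ ≤ 1) :
    ∀ᶠ L : ℝ in atTop,
      1 - θ ≤ (1 + θ) * L * (P {ω | ∃ k : ℕ, L ≤ (ω k : ℝ)}).toReal := by
  filter_upwards [tail_key σ hσ κ hmom hlb hvar hclt θ hθ (θ ^ 2 / 12) (by positivity),
    eventually_gt_atTop 1] with L hK hL
  obtain ⟨s, hs, hlb⟩ := hlb
  have hL0 : 0 < L := by linarith
  set M := (1 + θ) * L with hM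
  have hMpos : 0 < M := by positivity
  set f : ℕ → ℝ := fun m => (1 - θ) * min (m : ℝ) M + θ * (min (m : ℝ) M) ^ 2 / M with hf
  have hf0 : ∀ m, 0 ≤ f m := fun m => by
    have : 0 ≤ 1 - θ := by linarith
    have : 0 ≤ min (m : ℝ) M := by positivity
    simp only [hf]; positivity
  have hfM : ∀ m, f m ≤ M := fun m => by
    have h1 : 0 ≤ min (m : ℝ) M := by positivity
    have h2 : min (m : ℝ) M ≤ M := min_le_right _ _
    have h3 : (min (m : ℝ) M) ^ 2 / M ≤ M := by
      rw [div_le_iff₀ hMpos]; nlinarith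
    simp only [hf, mul_div_assoc]
    nlinarith
  have hfi : ∀ a, Integrable f (κ a) := fun a =>
    Integrable.of_bound (measurable_of_countable _).aestronglyMeasurable M
      (Eventually.of_forall fun m => by rw [Real.norm_of_nonneg (hf0 m)]; exact hfM m)
  have hint : ∀ a : ℕ, Integrable (fun m : ℕ => (m : ℝ)) (κ a) := fun a => by
    have h : MemLp (fun m : ℕ => (m : ℝ)) 2 (κ a) :=
      (memLp_two_iff_integrable_sq (measurable_of_countable _).aestronglyMeasurable).2 (hmom a)
    exact h.integrable (by norm_num)
  have hstep : ∀ a : ℕ, 1 ≤ a → (a : ℝ) < L → f a + θ * s / (4 * L) ≤ ∫ m, f m ∂(κ a) := by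
    intro a ha haL
    have ha0 : (0 : ℝ) < a := by exact_mod_cast ha
    have hi := int_sub_sq κ hmom a a
    have hi2 := hi.indicator (s := {m : ℕ | θ * L ≤ (m : ℝ) - a})
      (Set.to_countable _).measurableSet
    have haM : (a : ℝ) ≤ M := by nlinarith
    have hfa : f a = (1 - θ) * a + θ * a ^ 2 / M := by simp only [hf, min_eq_left haM]
    have hlin : Integrable (fun m : ℕ => f a +
        ((1 - θ) + 2 * θ * a / M) * ((m : ℝ) - a)) (κ a) :=
      (integrable_const _).add (((hint a).sub (integrable_const _)).const_mul _)
    have hcen : Integrable (fun m : ℕ => ((1 - θ) + 2 * θ * a / M) * ((m : ℝ) - a)) (κ a) :=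
      ((hint a).sub (integrable_const _)).const_mul _
    have hquad : Integrable (fun m : ℕ => f a + ((1 - θ) + 2 * θ * a / M) * ((m : ℝ) - a) +
        θ / (2 * L) * ((m : ℝ) - a) ^ 2) (κ a) := hlin.add (hi.const_mul _)
    have hmono : ∫ m : ℕ, (f a + ((1 - θ) + 2 * θ * a / M) * ((m : ℝ) - a) +
        θ / (2 * L) * ((m : ℝ) - a) ^ 2 - 3 / (θ * L) *
        {m : ℕ | θ * L ≤ (m : ℝ) - a}.indicator (fun m : ℕ => ((m : ℝ) - a) ^ 2) m) ∂(κ a) ≤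
        ∫ m, f m ∂(κ a) := by
      refine integral_mono ((hlin.add (hi.const_mul _)).sub (hi2.const_mul _)) (hfi a) fun m => ?_
      simp only [hfa]
      refine test_pointwise θ L a m hθ hθ1 hL0 ha0 haL (by positivity) _ ?_ ?_
      · exact Set.indicator_nonneg (fun m _ => sq_nonneg _) m
      · intro h
        rw [Set.indicator_of_mem (by exact h)]
    rw [integral_sub hquad (hi2.const_mul _),
      integral_add hlin (hi.const_mul _), integral_const_mul, integral_const_mul,
      integral_add (integrable_const _) hcen,
      integral_const_mul, integral_sub (hint a) (integrable_const _), hmart a] at hmono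
    simp only [integral_const, probReal_univ, one_smul, sub_self, mul_zero, add_zero] at hmono
    have hk := hK a ha haL
    have hv := hlb a ha
    set v := ∫ m, ((m : ℝ) - a) ^ 2 ∂(κ a) with hvdef
    have h1 : 3 / (θ * L) * ∫ m, {m : ℕ | θ * L ≤ (m : ℝ) - a}.indicator
        (fun m : ℕ => ((m : ℝ) - a) ^ 2) m ∂(κ a) ≤ 3 / (θ * L) * (θ ^ 2 / 12 * v) := by gcongr
    have h2 : 3 / (θ * L) * (θ ^ 2 / 12 * v) = θ * v / (4 * L) := by field_simp; ring
    have h3 : θ / (2 * L) * v = θ * v / (4 * L) + θ * v / (4 * L) := by field_simp; ring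
    have h4 : θ * s / (4 * L) ≤ θ * v / (4 * L) := by gcongr
    linarith
  have hlow := lower_bound κ P hP L hL (fun n => ENNReal.ofReal (f n)) (ENNReal.ofReal M)
    (ENNReal.ofReal (θ * s / (4 * L))) (fun n => ENNReal.ofReal_le_ofReal (hfM n))
    (by simp [hf, hMpos.le]) ENNReal.ofReal_ne_top
    (by rw [ne_eq, ENNReal.ofReal_eq_zero, not_le]; positivity)
    (by
      intro a ha haL
      rw [← ENNReal.ofReal_add (hf0 a) (by positivity),
        ← ofReal_integral_eq_lintegral_ofReal (hfi a) (Eventually.of_forall hf0)]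
      exact ENNReal.ofReal_le_ofReal (hstep a ha haL))
  have h1M : (1 : ℝ) ≤ M := by nlinarith
  have hf1 : 1 - θ ≤ f 1 := by
    simp only [hf, Nat.cast_one, min_eq_left h1M]
    have : 0 ≤ θ * 1 ^ 2 / M := by positivity
    linarith
  have hreal := ENNReal.toReal_mono
    (ENNReal.mul_ne_top ENNReal.ofReal_ne_top (measure_ne_top P _)) hlow
  rw [ENNReal.toReal_mul, ENNReal.toReal_ofReal (hf0 1), ENNReal.toReal_ofReal hMpos.le] at hreal
  exact hf1.trans hreal

/-- saturation of Doob's maximal inequality: for every fixed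
`ε ∈ (0,1/2)`, `εn · P₁(∃ k, A_k ≥ εn) → 1` as `n → ∞`. -/
theorem doob_saturation
    (σ : ℝ) (hσ : 0 < σ) (κ : Kernel ℕ ℕ) [IsMarkovKernel κ]
    -- finite second moments
    (hmom : ∀ n : ℕ, Integrable (fun m : ℕ => (m : ℝ) ^ 2) (κ n))
    -- martingale property
    (hmart : ∀ a : ℕ, ∫ m, (m : ℝ) ∂(κ a) = a)
    -- variance lower bound
    (hlb : ∃ s : ℝ, 0 < s ∧ ∀ n : ℕ, 1 ≤ n → s ≤ ∫ m, ((m : ℝ) - n) ^ 2 ∂(κ n))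
    -- variance asymptotics
    (hvar : Tendsto (fun n : ℕ => (∫ m, ((m : ℝ) - n) ^ 2 ∂(κ n)) / n) atTop
      (nhds (σ ^ 2)))
    -- one-step CLT
    (hclt : ∀ f : BoundedContinuousFunction ℝ ℝ,
      Tendsto (fun n : ℕ => ∫ m, f (((m : ℝ) - n) / Real.sqrt n) ∂(κ n)) atTop
        (nhds (∫ x, f x ∂(gaussianReal 0 (Real.toNNReal (σ ^ 2))))))
    (P : Measure (ℕ → ℕ)) [IsProbabilityMeasure P] (hP : IsChainLaw κ 1 P) :
    ∀ ε : ℝ, 0 < ε → ε < 1 / 2 →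
      Tendsto (fun n : ℕ =>
          ε * n * (P {ω | ∃ k : ℕ, ε * n ≤ (ω k : ℝ)}).toReal) atTop (nhds 1) := by
  intro ε hε hε2
  have hint : ∀ a : ℕ, Integrable (fun m : ℕ => (m : ℝ)) (κ a) := fun a => by
    have h : MemLp (fun m : ℕ => (m : ℝ)) 2 (κ a) :=
      (memLp_two_iff_integrable_sq (measurable_of_countable _).aestronglyMeasurable).2 (hmom a)
    exact h.integrable (by norm_num)
  have hm : ∀ a : ℕ, ∫⁻ m, (m : ℝ≥0∞) ∂(κ a) = a := by
    intro a
    have h := ofReal_integral_eq_lintegral_ofReal (hint a)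
      (Eventually.of_forall fun m => Nat.cast_nonneg m)
    rw [hmart a] at h
    simpa using h.symm
  have hLtop : Tendsto (fun n : ℕ => ε * (n : ℝ)) atTop atTop :=
    tendsto_natCast_atTop_atTop.const_mul_atTop hε
  rw [Metric.tendsto_atTop']
  intro δ hδ
  set θ := min (δ / 3) 1 with hθdef
  have hθ : 0 < θ := by positivity
  have hθ1 : θ ≤ 1 := min_le_right _ _
  have hθδ : θ ≤ δ / 3 := min_le_left _ _
  have hev := hLtop.eventually
    ((key_lower σ hσ κ hmom hmart hlb hvar hclt P hP θ hθ hθ1).and (eventually_gt_atTop 1))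
  obtain ⟨N, hN⟩ := eventually_atTop.1 hev
  refine ⟨N, fun n hn => ?_⟩
  obtain ⟨h1, h2⟩ := hN n hn.le
  have hup := ENNReal.toReal_mono ENNReal.one_ne_top (upper_bound κ P hP hm (ε * n) h2)
  rw [ENNReal.toReal_mul, ENNReal.toReal_ofReal (by linarith), ENNReal.toReal_one] at hup
  rw [mul_assoc] at h1
  set q := ε * n * (P {ω | ∃ k : ℕ, ε * n ≤ (ω k : ℝ)}).toReal with hq
  rw [Real.dist_eq, abs_lt]
  constructor <;> nlinarith
end
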